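/- For every natural number t with t < 2n, the (4n+1, 0) entry of the matrix power M_U^t is equal to zero. -/

import Mathlib

open Matrix

/-- The coin matrix `M_C = diag(1, R_A, …, R_A, R_A', …, R_A', 1)` (rows/columns
indexed by `0, …, 4n+1`), where `R_A = [[-1/3, 2√2/3], [2√2/3, 1/3]]` occupies the
index pairs `{2k-1, 2k}` for `k = 1, …, n` and `R_A' = [[1/3, 2√2/3], [2√2/3, -1/3]]`
the pairs `{2k-1, 2k}` for `k = n+1, …, 2n`. -/
noncomputable def MC (n : ℕ) : Matrix (Fin (4*n+2)) (Fin (4*n+2)) ℝ :=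
  Matrix.of fun i j =>
    if i = j then
      (if i.val = 0 ∨ i.val = 4*n+1 then 1
       else if i.val % 2 = 1 then (if i.val ≤ 2*n then -1/3 else 1/3)
       else (if i.val ≤ 2*n then 1/3 else -1/3))
    else if (i.val % 2 = 1 ∧ j.val = i.val + 1) ∨ (j.val % 2 = 1 ∧ i.val = j.val + 1) then
      2 * Real.sqrt 2 / 3
    else 0

/-- The shift matrix `M_S = diag(R_B, …, R_B)` with `2n+1` copies of
`R_B = [[0,1],[1,0]]`, on the index pairs `{0,1}, {2,3}, …, {4n, 4n+1}`. -/
noncomputable def MS (n : ℕ) : Matrix (Fin (4*n+2)) (Fin (4*n+2)) ℝ :=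
  Matrix.of fun i j => if i.val / 2 = j.val / 2 ∧ i ≠ j then 1 else 0

/-- The coined quantum walk matrix `M_U = M_S · M_C`. -/
noncomputable def MU (n : ℕ) : Matrix (Fin (4*n+2)) (Fin (4*n+2)) ℝ := MS n * MC n

/-- One step of the walk moves an amplitude by at most one shift block to the right. -/
theorem MU_apply_eq_zero {n : ℕ} {i j : Fin (4*n+2)} (h : j.val / 2 + 1 < i.val / 2) :
    MU n i j = 0 := by
  rw [MU, Matrix.mul_apply]
  refine Finset.sum_eq_zero fun k _ => ?_
  by_cases hik : i.val / 2 = k.val / 2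
  · have hC : MC n k j = 0 := by
      have hkj : k ≠ j := by rintro rfl; omega
      rw [MC, Matrix.of_apply, if_neg hkj, if_neg (by omega)]
    rw [hC, mul_zero]
  · have hS : MS n i k = 0 := by
      rw [MS, Matrix.of_apply, if_neg fun h => hik h.1]
    rw [hS, zero_mul]

/-- After `t` steps an amplitude has moved by at most `t` shift blocks to the right. -/
theorem MU_pow_apply_eq_zero {n : ℕ} (t : ℕ) {i j : Fin (4*n+2)}
    (h : j.val / 2 + t < i.val / 2) : ((MU n) ^ t) i j = 0 := by
  induction t generalizing i with
  | zero =>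
    rw [pow_zero, Matrix.one_apply_ne]
    rintro rfl
    omega
  | succ t ih =>
    rw [pow_succ', Matrix.mul_apply]
    refine Finset.sum_eq_zero fun k _ => ?_
    by_cases hk : j.val / 2 + t < k.val / 2
    · rw [ih hk, mul_zero]
    · rw [MU_apply_eq_zero (by omega), zero_mul]

/-- For every natural number `t < 2n`, the `(4n+1, 0)` entry of `M_U^t` is zero. -/
theorem stmt12 (n : ℕ) (hn : 0 < n) (t : ℕ) (ht : t < 2*n) :
    ((MU n) ^ t) ⟨4*n+1, by omega⟩ ⟨0, by omega⟩ = 0 := by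
  exact MU_pow_apply_eq_zero t (by dsimp only; omega)
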